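/- There exist constants 0 < c₁ ≤ c₂, depending only on the integers k ≥ 1 and n > 2k, such that for all μ₁, μ₂ > 0 and all ξ₁, ξ₂ ∈ ℝⁿ one has c₁ · ε₁₂ ≤ ∫_{ℝⁿ} U_{μ₁,ξ₁}^{2*_k − 1} U_{μ₂,ξ₂} dx ≤ c₂ · ε₁₂. -/

import Mathlib

open MeasureTheory Real

/-- The constant `𝔠_{n,k} := (∏_{j=-k}^{k-1} (n+2j))^{1/k}` (reindexed by `j ↦ j - k`). -/
noncomputable def cnk (n k : ℕ) : ℝ :=
  (∏ j ∈ Finset.range (2 * k), ((n : ℝ) + 2 * j - 2 * k)) ^ ((k : ℝ)⁻¹)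

/-- The standard bubble `U_{μ,ξ}(x) = μ^{(n-2k)/2} (μ² + 𝔠_{n,k}⁻¹ |x-ξ|²)^{(2k-n)/2}`. -/
noncomputable def stdBubble (n k : ℕ) (μ : ℝ) (ξ x : EuclideanSpace ℝ (Fin n)) : ℝ :=
  μ ^ (((n : ℝ) - 2 * k) / 2) *
    (μ ^ 2 + (cnk n k)⁻¹ * ‖x - ξ‖ ^ 2) ^ (((2 * k : ℝ) - n) / 2)

/-- The interaction quantity
`ε₁₂ = (μ₁/μ₂ + μ₂/μ₁ + 𝔠_{n,k}⁻¹ |ξ₁-ξ₂|²/(μ₁μ₂))^{(2k-n)/2}`. -/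
noncomputable def interact (n k : ℕ) (μ₁ μ₂ : ℝ)
    (ξ₁ ξ₂ : EuclideanSpace ℝ (Fin n)) : ℝ :=
  (μ₁ / μ₂ + μ₂ / μ₁ + (cnk n k)⁻¹ * ‖ξ₁ - ξ₂‖ ^ 2 / (μ₁ * μ₂)) ^ (((2 * k : ℝ) - n) / 2)

/-- The radial profile `(1 + |z|²)^{-2k} |z|^{-2m}`, with `2m = n - 2k`, is integrable on `ℝⁿ`. -/
lemma integrable_one_add_norm_sq_mul_norm_sq_rpow (k n : ℕ) (hk : 1 ≤ k) (hn : 2 * k < n) :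
    Integrable (fun z : EuclideanSpace ℝ (Fin n) =>
      (1 + ‖z‖ ^ 2) ^ (-(2 * k : ℝ)) * (‖z‖ ^ 2) ^ (-(((n : ℝ) - 2 * k) / 2))) := by
  have : Nonempty (Fin n) := ⟨⟨0, by omega⟩⟩
  have hk' : (1 : ℝ) ≤ k := by exact_mod_cast hk
  rw [integrable_fun_norm_addHaar (μ := volume)
    (f := fun r : ℝ => (1 + r ^ 2) ^ (-(2 * k : ℝ)) * (r ^ 2) ^ (-(((n : ℝ) - 2 * k) / 2)))]
  refine Integrable.mono' (integrable_inv_one_add_sq.integrableOn) ?_ ?_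
  · exact (by fun_prop : Measurable _).aestronglyMeasurable
  · refine (ae_restrict_mem measurableSet_Ioi).mono fun r hr => ?_
    have hr : 0 < r := hr
    have hpos : 0 < 1 + r ^ 2 := by positivity
    rw [finrank_euclideanSpace_fin, smul_eq_mul, Real.norm_of_nonneg (by positivity)]
    have h1 : r ^ (n - 1) * (r ^ 2) ^ (-(((n : ℝ) - 2 * k) / 2)) = (r ^ 2) ^ ((2 * k - 1 : ℝ) / 2) := by
      rw [← Real.rpow_natCast r (n - 1), ← Real.rpow_natCast r 2, ← Real.rpow_mul hr.le,
        ← Real.rpow_mul hr.le, ← Real.rpow_add hr]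
      congr 1
      push_cast [Nat.cast_sub (by omega : 1 ≤ n)]
      ring
    calc r ^ (n - 1) * ((1 + r ^ 2) ^ (-(2 * k : ℝ)) * (r ^ 2) ^ (-(((n : ℝ) - 2 * k) / 2)))
        = (1 + r ^ 2) ^ (-(2 * k : ℝ)) * (r ^ 2) ^ ((2 * k - 1 : ℝ) / 2) := by
          rw [← h1]; ring
      _ ≤ (1 + r ^ 2) ^ (-(2 * k : ℝ)) * (1 + r ^ 2) ^ ((2 * k - 1 : ℝ) / 2) := by
          gcongr
          · linarith
          · linarith
      _ = (1 + r ^ 2) ^ (-(k + 1 / 2 : ℝ)) := by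
          rw [← Real.rpow_add hpos]; congr 1; ring
      _ ≤ (1 + r ^ 2) ^ (-1 : ℝ) := by
          apply Real.rpow_le_rpow_of_exponent_le
          · nlinarith [sq_nonneg r]
          · linarith
      _ = (1 + r ^ 2)⁻¹ := Real.rpow_neg_one _

lemma integrable_one_add_norm_sq_rpow (k n : ℕ) (hk : 1 ≤ k) :
    Integrable (fun y : EuclideanSpace ℝ (Fin n) =>
      (1 + ‖y‖ ^ 2) ^ (-(((n : ℝ) - 2 * k) / 2 + 2 * k))) := by
  have hk' : (1 : ℝ) ≤ k := by exact_mod_cast hk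
  have := integrable_rpow_neg_one_add_norm_sq (E := EuclideanSpace ℝ (Fin n)) (μ := volume)
    (r := (n : ℝ) + 2 * k) (by rw [finrank_euclideanSpace_fin]; linarith)
  convert this using 3
  ring

/-- Either `v` is comparable to `b`, or both `u` and `v` are controlled by `w`. -/
lemma rpow_mul_rpow_le_interaction {m q u v w b : ℝ} (hm : 0 < m) (hq : 0 < q) (hb : 1 ≤ b)
    (hu : 1 ≤ u) (hw : 0 < w) (hwv : w ≤ v) (hbuv : b ≤ 2 * u + 2 * v) :
    u ^ (-(m + q)) * v ^ (-m) ≤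
      4 ^ m * 5 ^ q * b ^ (-m) * (u ^ (-(m + q)) + (1 + w) ^ (-q) * w ^ (-m)) := by
  have hv : 0 < v := hw.trans_le hwv
  have hu0 : 0 < u := by linarith
  have hb0 : 0 < b := by linarith
  have hquarter : (b / 4) ^ (-m) = 4 ^ m * b ^ (-m) := by
    rw [Real.div_rpow hb0.le (by norm_num), Real.rpow_neg (by norm_num : (0 : ℝ) ≤ 4)]
    field_simp
  have hfifth : ((1 + w) / 5) ^ (-q) = 5 ^ q * (1 + w) ^ (-q) := by
    rw [Real.div_rpow (by positivity) (by norm_num), Real.rpow_neg (by norm_num : (0 : ℝ) ≤ 5)]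
    field_simp
  rcases le_or_gt (b / 4) v with h | h
  · have h1 : v ^ (-m) ≤ 4 ^ m * b ^ (-m) := by
      rw [← hquarter]
      exact Real.rpow_le_rpow_of_nonpos (by positivity) h (by linarith)
    have h5 : (1 : ℝ) ≤ 5 ^ q := Real.one_le_rpow (by norm_num) hq.le
    calc u ^ (-(m + q)) * v ^ (-m) ≤ u ^ (-(m + q)) * (4 ^ m * b ^ (-m)) := by gcongr
      _ = 4 ^ m * 1 * b ^ (-m) * (u ^ (-(m + q)) + 0) := by ring
      _ ≤ _ := by gcongr; positivity
  · have h1 : u ^ (-m) ≤ 4 ^ m * b ^ (-m) := by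
      rw [← hquarter]
      exact Real.rpow_le_rpow_of_nonpos (by positivity) (by linarith) (by linarith)
    have h2 : u ^ (-q) ≤ 5 ^ q * (1 + w) ^ (-q) := by
      rw [← hfifth]
      exact Real.rpow_le_rpow_of_nonpos (by positivity) (by linarith) (by linarith)
    have h3 : v ^ (-m) ≤ w ^ (-m) := Real.rpow_le_rpow_of_nonpos hw hwv (by linarith)
    calc u ^ (-(m + q)) * v ^ (-m) = u ^ (-m) * u ^ (-q) * v ^ (-m) := by
          rw [neg_add, Real.rpow_add hu0]
      _ ≤ (4 ^ m * b ^ (-m)) * (5 ^ q * (1 + w) ^ (-q)) * w ^ (-m) := by gcongr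
      _ = 4 ^ m * 5 ^ q * b ^ (-m) * (0 + (1 + w) ^ (-q) * w ^ (-m)) := by ring
      _ ≤ _ := by gcongr; positivity

/-- The interaction estimate after normalizing the first bubble to be centred at `0` at unit
scale. -/
lemma normalized_interaction_bounds (k n : ℕ) (hk : 1 ≤ k) (hn : 2 * k < n) {m : ℝ}
    (hm : m = ((n : ℝ) - 2 * k) / 2) :
    ∃ c₁ c₂ : ℝ, 0 < c₁ ∧ c₁ ≤ c₂ ∧ ∀ l : ℝ, 0 < l → ∀ e : EuclideanSpace ℝ (Fin n),
      c₁ * (1 + l ^ 2 + ‖e‖ ^ 2) ^ (-m) ≤ (∫ y : EuclideanSpace ℝ (Fin n),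
          (1 + ‖y‖ ^ 2) ^ (-(m + 2 * k)) * (l ^ 2 + ‖y + e‖ ^ 2) ^ (-m)) ∧
        (∫ y : EuclideanSpace ℝ (Fin n),
          (1 + ‖y‖ ^ 2) ^ (-(m + 2 * k)) * (l ^ 2 + ‖y + e‖ ^ 2) ^ (-m)) ≤
        c₂ * (1 + l ^ 2 + ‖e‖ ^ 2) ^ (-m) := by
  have : Nonempty (Fin n) := ⟨⟨0, by omega⟩⟩
  have hk' : (1 : ℝ) ≤ k := by exact_mod_cast hk
  have hm0 : 0 < m := by
    have : (2 * k : ℝ) < n := by exact_mod_cast hn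
    rw [hm]; linarith
  set F : EuclideanSpace ℝ (Fin n) → ℝ := fun y => (1 + ‖y‖ ^ 2) ^ (-(m + 2 * k)) with hF
  set G : EuclideanSpace ℝ (Fin n) → ℝ :=
    fun z => (1 + ‖z‖ ^ 2) ^ (-(2 * k : ℝ)) * (‖z‖ ^ 2) ^ (-m) with hG
  have hFi : Integrable F := by
    rw [hF, hm]; exact integrable_one_add_norm_sq_rpow k n hk
  have hGi : Integrable G := by
    rw [hG, hm]; exact integrable_one_add_norm_sq_mul_norm_sq_rpow k n hk hn
  set V : ℝ := volume.real (Metric.closedBall (0 : EuclideanSpace ℝ (Fin n)) 1) with hV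
  have hV0 : 0 < V := by
    rw [hV, measureReal_def]
    exact ENNReal.toReal_pos (Metric.measure_closedBall_pos _ _ one_pos).ne'
      measure_closedBall_lt_top.ne
  set C : ℝ := 4 ^ m * 5 ^ (2 * k : ℝ)
  refine ⟨V * (2 ^ (-(m + 2 * k)) * 2 ^ (-m)),
    max (V * (2 ^ (-(m + 2 * k)) * 2 ^ (-m))) (C * ((∫ y, F y) + ∫ z, G z)),
    by positivity, le_max_left _ _, fun l hl e => ?_⟩
  set b : ℝ := 1 + l ^ 2 + ‖e‖ ^ 2 with hb
  have hb1 : 1 ≤ b := by rw [hb]; nlinarith [sq_nonneg l, sq_nonneg ‖e‖]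
  set I : EuclideanSpace ℝ (Fin n) → ℝ :=
    fun y => (1 + ‖y‖ ^ 2) ^ (-(m + 2 * k)) * (l ^ 2 + ‖y + e‖ ^ 2) ^ (-m) with hI
  have hI0 : ∀ y, 0 ≤ I y := fun y => by rw [hI]; positivity
  have hGe : Integrable fun y => G (y + e) := hGi.comp_add_right e
  have hbound : ∀ᵐ y, I y ≤ C * b ^ (-m) * (F y + G (y + e)) := by
    have hne : ∀ᵐ y : EuclideanSpace ℝ (Fin n), y ≠ -e := by
      simp [ae_iff]
    filter_upwards [hne] with y hy
    have hy' : 0 < ‖y + e‖ := by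
      rw [norm_pos_iff]; exact fun h => hy (eq_neg_of_add_eq_zero_left h)
    refine rpow_mul_rpow_le_interaction hm0 (by positivity) hb1
      (by nlinarith [sq_nonneg ‖y‖]) (by positivity) (by nlinarith) ?_
    have htri : ‖e‖ ≤ ‖y + e‖ + ‖y‖ := by
      simpa using norm_sub_le (y + e) y
    have := norm_nonneg e
    have : ‖e‖ ^ 2 ≤ (‖y + e‖ + ‖y‖) ^ 2 := by gcongr
    nlinarith [sq_nonneg (‖y + e‖ - ‖y‖), sq_nonneg l]
  have hdom : Integrable fun y => C * b ^ (-m) * (F y + G (y + e)) :=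
    (hFi.add hGe).const_mul _
  have hIi : Integrable I := by
    refine hdom.mono' (by fun_prop : Measurable I).aestronglyMeasurable ?_
    filter_upwards [hbound] with y hy
    rwa [Real.norm_of_nonneg (hI0 y)]
  constructor
  · have hball : ∀ y ∈ Metric.closedBall (0 : EuclideanSpace ℝ (Fin n)) 1,
        2 ^ (-(m + 2 * k)) * (2 ^ (-m) * b ^ (-m)) ≤ I y := by
      intro y hy
      have hy : ‖y‖ ≤ 1 := by simpa using hy
      have hy2 : ‖y‖ ^ 2 ≤ 1 := by nlinarith [norm_nonneg y]
      have htri := norm_add_le y e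
      have hsq : ‖y + e‖ ^ 2 ≤ (‖y‖ + ‖e‖) ^ 2 := by gcongr
      rw [← Real.mul_rpow (by norm_num) (by linarith), hI]
      refine mul_le_mul (Real.rpow_le_rpow_of_nonpos (by positivity) (by linarith) ?_)
        (Real.rpow_le_rpow_of_nonpos (by positivity) ?_ (by linarith)) (by positivity)
        (by positivity)
      · linarith
      · nlinarith [sq_nonneg (‖y‖ - ‖e‖), sq_nonneg l]
    calc V * (2 ^ (-(m + 2 * k)) * 2 ^ (-m)) * b ^ (-m)
        = ∫ _ in Metric.closedBall (0 : EuclideanSpace ℝ (Fin n)) 1,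
            2 ^ (-(m + 2 * k)) * (2 ^ (-m) * b ^ (-m)) := by
          rw [setIntegral_const, smul_eq_mul]; ring
      _ ≤ ∫ y in Metric.closedBall (0 : EuclideanSpace ℝ (Fin n)) 1, I y :=
          setIntegral_mono_on (integrableOn_const measure_closedBall_lt_top.ne)
            hIi.integrableOn Metric.isClosed_closedBall.measurableSet hball
      _ ≤ ∫ y, I y := setIntegral_le_integral hIi (Filter.Eventually.of_forall hI0)
  · calc ∫ y, I y ≤ ∫ y, C * b ^ (-m) * (F y + G (y + e)) := integral_mono_ae hIi hdom hbound
      _ = C * ((∫ y, F y) + ∫ z, G z) * b ^ (-m) := by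
          rw [integral_const_mul, integral_add hFi hGe, integral_add_right_eq_self G e]; ring
      _ ≤ _ := by gcongr; exact le_max_right _ _

lemma cnk_pos {n k : ℕ} (hn : 2 * k < n) : 0 < cnk n k := by
  refine Real.rpow_pos_of_pos (Finset.prod_pos fun j _ => ?_) _
  have : (2 * k : ℝ) < n := by exact_mod_cast hn
  have : (0 : ℝ) ≤ j := j.cast_nonneg
  linarith

lemma rpow_mul_sq_mul_rpow {m s u : ℝ} (hs : 0 < s) (hu : 0 < u) :
    s ^ m * (s ^ 2 * u) ^ (-m) = s ^ (-m) * u ^ (-m) := by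
  rw [Real.mul_rpow (by positivity) hu.le, ← mul_assoc, ← Real.rpow_natCast s 2,
    ← Real.rpow_mul hs.le, ← Real.rpow_add hs]
  congr 2
  push_cast
  ring

/-- The interaction integral after the change of variables `x = ξ₁ + t • y`, with
`t = μ₁ 𝔠_{n,k}^{1/2}`. -/
lemma integral_stdBubble_eq (k n : ℕ) (hn : 2 * k < n) {m t μ₁ μ₂ : ℝ}
    (hm : m = ((n : ℝ) - 2 * k) / 2) (h₁ : 0 < μ₁) (h₂ : 0 < μ₂)
    (ht : t = μ₁ * √(cnk n k)) (ξ₁ ξ₂ : EuclideanSpace ℝ (Fin n)) :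
    (∫ x : EuclideanSpace ℝ (Fin n),
      stdBubble n k μ₁ ξ₁ x ^ (((n : ℝ) + 2 * k) / ((n : ℝ) - 2 * k)) *
        stdBubble n k μ₂ ξ₂ x) =
    √(cnk n k) ^ n * (μ₂ / μ₁) ^ m * ∫ y : EuclideanSpace ℝ (Fin n),
      (1 + ‖y‖ ^ 2) ^ (-(m + 2 * k)) *
        ((μ₂ / μ₁) ^ 2 + ‖y + t⁻¹ • (ξ₁ - ξ₂)‖ ^ 2) ^ (-m) := by
  have hc := cnk_pos hn
  have hm0 : 0 < m := by
    have : (2 * k : ℝ) < n := by exact_mod_cast hn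
    rw [hm]; linarith
  have hs : 0 < √(cnk n k) := Real.sqrt_pos.2 hc
  have ht0 : 0 < t := by rw [ht]; positivity
  have ht2 : (cnk n k)⁻¹ * t ^ 2 = μ₁ ^ 2 := by
    rw [ht, mul_pow, Real.sq_sqrt hc.le]; field_simp
  set f : EuclideanSpace ℝ (Fin n) → ℝ := fun x =>
    stdBubble n k μ₁ ξ₁ x ^ (((n : ℝ) + 2 * k) / ((n : ℝ) - 2 * k)) * stdBubble n k μ₂ ξ₂ x
    with hf
  have hcv : ∫ x, f x = t ^ n * ∫ y, f (ξ₁ + t • y) := by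
    rw [Measure.integral_comp_smul volume (fun y => f (ξ₁ + y)) t, integral_add_left_eq_self f ξ₁,
      finrank_euclideanSpace_fin, smul_eq_mul, abs_of_pos (by positivity)]
    field_simp
  have hm1 : ((2 * k : ℝ) - n) / 2 = -m := by rw [hm]; ring
  have hp : ((n : ℝ) + 2 * k) / ((n : ℝ) - 2 * k) = (m + 2 * k) / m := by
    rw [hm]
    have : (n : ℝ) - 2 * k ≠ 0 := by rw [hm] at hm0; linarith
    field_simp
    ring
  have hpt : ∀ y, f (ξ₁ + t • y) = μ₁ ^ (-(m + 2 * k)) * (μ₂ ^ m * μ₁ ^ (-(2 * m))) *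
      ((1 + ‖y‖ ^ 2) ^ (-(m + 2 * k)) *
        ((μ₂ / μ₁) ^ 2 + ‖y + t⁻¹ • (ξ₁ - ξ₂)‖ ^ 2) ^ (-m)) := by
    intro y
    have e1 : ξ₁ + t • y - ξ₁ = t • y := by abel
    have e2 : ξ₁ + t • y - ξ₂ = t • (y + t⁻¹ • (ξ₁ - ξ₂)) := by
      rw [smul_add, smul_inv_smul₀ ht0.ne']; abel
    have q1 : μ₁ ^ 2 + (cnk n k)⁻¹ * ‖t • y‖ ^ 2 = μ₁ ^ 2 * (1 + ‖y‖ ^ 2) := by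
      rw [norm_smul, mul_pow, Real.norm_of_nonneg ht0.le, ← mul_assoc, ht2]; ring
    have q2 : μ₂ ^ 2 + (cnk n k)⁻¹ * ‖t • (y + t⁻¹ • (ξ₁ - ξ₂))‖ ^ 2 =
        μ₁ ^ 2 * ((μ₂ / μ₁) ^ 2 + ‖y + t⁻¹ • (ξ₁ - ξ₂)‖ ^ 2) := by
      rw [norm_smul, mul_pow, Real.norm_of_nonneg ht0.le, ← mul_assoc, ht2]; field_simp
    have b1 : stdBubble n k μ₁ ξ₁ (ξ₁ + t • y) = (μ₁ * (1 + ‖y‖ ^ 2)) ^ (-m) := by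
      rw [stdBubble, e1, q1, hm1, ← hm, rpow_mul_sq_mul_rpow h₁ (by positivity),
        Real.mul_rpow h₁.le (by positivity)]
    have b2 : stdBubble n k μ₂ ξ₂ (ξ₁ + t • y) = μ₂ ^ m * μ₁ ^ (-(2 * m)) *
        ((μ₂ / μ₁) ^ 2 + ‖y + t⁻¹ • (ξ₁ - ξ₂)‖ ^ 2) ^ (-m) := by
      rw [stdBubble, e2, q2, hm1, ← hm, Real.mul_rpow (by positivity) (by positivity),
        ← Real.rpow_natCast μ₁ 2, ← Real.rpow_mul h₁.le, ← mul_assoc]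
      congr 3
      push_cast
      ring
    rw [hf]
    simp only [b1, b2, hp]
    rw [← Real.rpow_mul (by positivity), show -m * ((m + 2 * k) / m) = -(m + 2 * k) by field_simp,
      Real.mul_rpow h₁.le (by positivity)]
    ring
  rw [hcv]
  simp only [hpt]
  rw [integral_const_mul, ← mul_assoc]
  congr 1
  rw [ht, mul_pow, Real.div_rpow h₂.le h₁.le, div_eq_mul_inv, ← Real.rpow_neg h₁.le]
  have hμ : μ₁ ^ n * μ₁ ^ (-(m + 2 * k)) * μ₁ ^ (-(2 * m)) = μ₁ ^ (-m) := by
    rw [← Real.rpow_natCast, ← Real.rpow_add h₁, ← Real.rpow_add h₁]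
    congr 1
    rw [hm]; ring
  rw [← hμ]
  ring

lemma interact_eq (k n : ℕ) (hn : 2 * k < n) {m t μ₁ μ₂ : ℝ}
    (hm : m = ((n : ℝ) - 2 * k) / 2) (h₁ : 0 < μ₁) (h₂ : 0 < μ₂)
    (ht : t = μ₁ * √(cnk n k)) (ξ₁ ξ₂ : EuclideanSpace ℝ (Fin n)) :
    interact n k μ₁ μ₂ ξ₁ ξ₂ = (μ₂ / μ₁) ^ m *
      (1 + (μ₂ / μ₁) ^ 2 + ‖t⁻¹ • (ξ₁ - ξ₂)‖ ^ 2) ^ (-m) := by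
  have hc := cnk_pos hn
  have hl : 0 < μ₂ / μ₁ := by positivity
  have hm1 : ((2 * k : ℝ) - n) / 2 = -m := by rw [hm]; ring
  have hnorm : ‖t⁻¹ • (ξ₁ - ξ₂)‖ ^ 2 = (μ₁ ^ 2 * cnk n k)⁻¹ * ‖ξ₁ - ξ₂‖ ^ 2 := by
    rw [norm_smul, mul_pow, Real.norm_eq_abs, sq_abs, ht, inv_pow, mul_pow, Real.sq_sqrt hc.le]
  rw [interact, hm1, hnorm, ← inv_inv ((μ₂ / μ₁) ^ m), ← Real.rpow_neg hl.le,
    ← Real.inv_rpow hl.le, ← Real.mul_rpow (by positivity) (by positivity)]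
  congr 1
  field_simp

theorem stmt12 (k n : ℕ) (hk : 1 ≤ k) (hn : 2 * k < n) :
    ∃ c₁ c₂ : ℝ, 0 < c₁ ∧ c₁ ≤ c₂ ∧
      ∀ μ₁ μ₂ : ℝ, 0 < μ₁ → 0 < μ₂ → ∀ ξ₁ ξ₂ : EuclideanSpace ℝ (Fin n),
        c₁ * interact n k μ₁ μ₂ ξ₁ ξ₂ ≤
            (∫ x : EuclideanSpace ℝ (Fin n),
              stdBubble n k μ₁ ξ₁ x ^ (((n : ℝ) + 2 * k) / ((n : ℝ) - 2 * k)) *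
                stdBubble n k μ₂ ξ₂ x) ∧
          (∫ x : EuclideanSpace ℝ (Fin n),
              stdBubble n k μ₁ ξ₁ x ^ (((n : ℝ) + 2 * k) / ((n : ℝ) - 2 * k)) *
                stdBubble n k μ₂ ξ₂ x) ≤
            c₂ * interact n k μ₁ μ₂ ξ₁ ξ₂ := by
  obtain ⟨c₁, c₂, hc₁, hc, hbd⟩ :=
    normalized_interaction_bounds k n hk hn (m := ((n : ℝ) - 2 * k) / 2) rfl
  have hs : 0 < √(cnk n k) ^ n := pow_pos (Real.sqrt_pos.2 (cnk_pos hn)) n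
  refine ⟨√(cnk n k) ^ n * c₁, √(cnk n k) ^ n * c₂, by positivity, by gcongr,
    fun μ₁ μ₂ h₁ h₂ ξ₁ ξ₂ => ?_⟩
  obtain ⟨hlo, hhi⟩ := hbd (μ₂ / μ₁) (by positivity) ((μ₁ * √(cnk n k))⁻¹ • (ξ₁ - ξ₂))
  have hs' : 0 ≤ √(cnk n k) ^ n * (μ₂ / μ₁) ^ (((n : ℝ) - 2 * k) / 2) := by positivity
  rw [integral_stdBubble_eq k n hn rfl h₁ h₂ rfl, interact_eq k n hn rfl h₁ h₂ rfl]
  constructor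
  · refine le_of_eq_of_le ?_ (mul_le_mul_of_nonneg_left hlo hs')
    ring
  · refine (mul_le_mul_of_nonneg_left hhi hs').trans_eq ?_
    ring
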